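/- Let N, n ≥ 1 and let φ : [0,∞) → [0,∞) be differentiable with derivative φ', with φ(0) = 0, and let 1 < p₁ ≤ p₂ be such that p₁·φ(t) ≤ t·φ'(t) ≤ p₂·φ(t) for all t > 0. Then there exists a constant c ≥ 1, depending only on p₁ and p₂, such that for all P₀, P₁ ∈ ℝ^{N×n} with |P₀| + |P₁| > 0: c^{−1}·φ'(|P₀| + |P₁|)/(|P₀| + |P₁|) ≤ ∫₀¹ φ'(|(1−θ)·P₀ + θ·P₁|)/|(1−θ)·P₀ + θ·P₁| dθ ≤ c·φ'(|P₀| + |P₁|)/(|P₀| + |P₁|), where the integrand is interpreted as 0 at the (at most one) value of θ where (1−θ)·P₀ + θ·P₁ = 0. -/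

import Mathlib

open MeasureTheory Set

/-- If `q * φ t ≤ t * φ' t` on `(0, ∞)`, then `t ↦ φ t * t ^ (-q)` is nondecreasing there. -/
lemma monotoneOn_mul_rpow_neg {φ φ' : ℝ → ℝ} {q : ℝ}
    (hd : ∀ t > (0 : ℝ), HasDerivAt φ (φ' t) t) (h : ∀ t > (0 : ℝ), q * φ t ≤ t * φ' t) :
    MonotoneOn (fun t => φ t * t ^ (-q)) (Ioi 0) := by
  have key : ∀ t > (0 : ℝ), HasDerivAt (fun t => φ t * t ^ (-q))
      (φ' t * t ^ (-q) + φ t * (-q * t ^ (-q - 1))) t := fun t ht =>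
    (hd t ht).mul (Real.hasDerivAt_rpow_const (Or.inl ht.ne'))
  refine monotoneOn_of_deriv_nonneg (convex_Ioi 0)
    (fun t ht => (key t ht).continuousAt.continuousWithinAt) ?_ ?_ <;> rw [interior_Ioi]
  · exact fun t ht => (key t ht).differentiableAt.differentiableWithinAt
  · intro t ht
    have ht : 0 < t := ht
    rw [(key t ht).deriv]
    have e : t ^ (-q) = t * t ^ (-q - 1) := by
      rw [Real.rpow_sub_one ht.ne']; field_simp
    have := mul_nonneg (sub_nonneg.2 (h t ht)) (Real.rpow_pos_of_pos ht (-q - 1)).le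
    rw [e]
    linarith

/-- A lower index `q` gives `φ t ≤ φ s * (t / s) ^ q` for `0 < t ≤ s`. -/
lemma le_mul_div_rpow_of_mul_le {φ φ' : ℝ → ℝ} {q s t : ℝ}
    (hd : ∀ t > (0 : ℝ), HasDerivAt φ (φ' t) t) (h : ∀ t > (0 : ℝ), q * φ t ≤ t * φ' t)
    (ht : 0 < t) (hts : t ≤ s) : φ t ≤ φ s * (t / s) ^ q := by
  have hs := ht.trans_le hts
  have := monotoneOn_mul_rpow_neg hd h ht hs hts
  simp only [Real.rpow_neg ht.le, Real.rpow_neg hs.le] at this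
  rw [Real.div_rpow ht.le hs.le]
  have htq := Real.rpow_pos_of_pos ht q
  rw [← div_eq_mul_inv, div_le_iff₀ htq] at this
  calc φ t ≤ _ := this
    _ = _ := by ring

/-- An upper index `q` gives `φ s * (t / s) ^ q ≤ φ t` for `0 < t ≤ s`. -/
lemma mul_div_rpow_le_of_le_mul {φ φ' : ℝ → ℝ} {q s t : ℝ}
    (hd : ∀ t > (0 : ℝ), HasDerivAt φ (φ' t) t) (h : ∀ t > (0 : ℝ), t * φ' t ≤ q * φ t)
    (ht : 0 < t) (hts : t ≤ s) : φ s * (t / s) ^ q ≤ φ t := by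
  have := le_mul_div_rpow_of_mul_le (φ := fun t => -φ t) (φ' := fun t => -φ' t) (q := q)
    (fun t ht => (hd t ht).neg) (fun t ht => by linarith [h t ht]) ht hts
  linarith

lemma intervalIntegrable_abs_sub_rpow_left {a r : ℝ} (hr : -1 < r) (ha : 0 ≤ a) :
    IntervalIntegrable (fun θ => |a - θ| ^ r) volume 0 a ∧
      ∫ θ in (0 : ℝ)..a, |a - θ| ^ r = a ^ (r + 1) / (r + 1) := by
  have e : EqOn (fun θ => (a - θ) ^ r) (fun θ => |a - θ| ^ r) (uIcc 0 a) := by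
    intro θ hθ
    rw [uIcc_of_le ha] at hθ
    simp only [abs_of_nonneg (sub_nonneg.2 hθ.2)]
  constructor
  · have := ((intervalIntegral.intervalIntegrable_rpow' (a := 0) (b := a) hr).comp_sub_left a).symm
    simp only [sub_self, sub_zero] at this
    exact this.congr (fun θ hθ => e (uIoc_subset_uIcc hθ))
  · rw [← intervalIntegral.integral_congr e,
      intervalIntegral.integral_comp_sub_left (fun x => x ^ r) a, integral_rpow (Or.inl hr),
      sub_self, sub_zero, Real.zero_rpow (by linarith), sub_zero]

lemma intervalIntegrable_abs_sub_rpow_right {a r : ℝ} (hr : -1 < r) (ha : a ≤ 1) :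
    IntervalIntegrable (fun θ => |a - θ| ^ r) volume a 1 ∧
      ∫ θ in a..1, |a - θ| ^ r = (1 - a) ^ (r + 1) / (r + 1) := by
  obtain ⟨h1, h2⟩ := intervalIntegrable_abs_sub_rpow_left hr (sub_nonneg.2 ha)
  have e : ∀ θ, |1 - a - (1 - θ)| ^ r = |a - θ| ^ r := fun θ => by
    rw [abs_sub_comm a θ]; ring_nf
  constructor
  · have := (h1.comp_sub_left 1).symm
    simpa only [e, sub_zero, sub_sub_cancel] using this
  · have := intervalIntegral.integral_comp_sub_left (a := a) (b := 1)
      (fun θ => |1 - a - θ| ^ r) 1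
    simp only [e, sub_self] at this
    rw [this, h2]

lemma intervalIntegrable_abs_sub_rpow {a r : ℝ} (hr : -1 < r) (ha : a ∈ Icc (0 : ℝ) 1) :
    IntervalIntegrable (fun θ => |a - θ| ^ r) volume 0 1 :=
  (intervalIntegrable_abs_sub_rpow_left hr ha.1).1.trans
    (intervalIntegrable_abs_sub_rpow_right hr ha.2).1

lemma integral_abs_sub_rpow {a r : ℝ} (hr : -1 < r) (ha : a ∈ Icc (0 : ℝ) 1) :
    ∫ θ in (0 : ℝ)..1, |a - θ| ^ r = (a ^ (r + 1) + (1 - a) ^ (r + 1)) / (r + 1) := by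
  obtain ⟨h1, h2⟩ := intervalIntegrable_abs_sub_rpow_left hr ha.1
  obtain ⟨h3, h4⟩ := intervalIntegrable_abs_sub_rpow_right hr ha.2
  rw [← intervalIntegral.integral_add_adjacent_intervals h1 h3, h2, h4, add_div]

lemma integral_abs_sub_rpow_le {a r : ℝ} (hr : -1 < r) (ha : a ∈ Icc (0 : ℝ) 1) :
    ∫ θ in (0 : ℝ)..1, |a - θ| ^ r ≤ 2 / (r + 1) := by
  have hr' : 0 < r + 1 := by linarith
  rw [integral_abs_sub_rpow hr ha]
  gcongr
  linarith [Real.rpow_le_one ha.1 ha.2 hr'.le,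
    Real.rpow_le_one (sub_nonneg.2 ha.2) (sub_le_self 1 ha.1) hr'.le]

lemma le_integral_abs_sub_rpow {a r : ℝ} (hr : -1 < r) (ha : a ∈ Icc (0 : ℝ) 1) :
    (1 / 2) ^ (r + 1) / (r + 1) ≤ ∫ θ in (0 : ℝ)..1, |a - θ| ^ r := by
  have hr' : 0 < r + 1 := by linarith
  rw [integral_abs_sub_rpow hr ha]
  gcongr
  have h1 := Real.rpow_nonneg ha.1 (r + 1)
  have h2 := Real.rpow_nonneg (sub_nonneg.2 ha.2) (r + 1)
  rcases le_total (1 / 2) a with h | h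
  · linarith [Real.rpow_le_rpow (by norm_num) h hr'.le]
  · linarith [Real.rpow_le_rpow (by norm_num) (show 1 / 2 ≤ 1 - a by linarith) hr'.le]

section Segment

variable {φ φ' : ℝ → ℝ} {p₁ p₂ : ℝ}

lemma deriv_div_le {q s t x : ℝ} (hd : ∀ t > (0 : ℝ), HasDerivAt φ (φ' t) t)
    (h0 : ∀ t > (0 : ℝ), 0 ≤ φ t) (hp₂ : 0 ≤ p₂)
    (h1 : ∀ t > (0 : ℝ), q * φ t ≤ t * φ' t) (h2 : ∀ t > (0 : ℝ), t * φ' t ≤ p₂ * φ t)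
    (hq : q ≤ 2) (hx : 0 < x) (hxt : x ≤ t / s) (hs : 0 < s) (hts : t ≤ s) :
    φ' t / t ≤ p₂ * (φ s / s ^ 2) * x ^ (q - 2) := by
  have hu : 0 < t / s := hx.trans_le hxt
  have ht : 0 < t := by simpa [hs.ne'] using mul_pos hu hs
  have e : (t / s) ^ (q - 2) = (t / s) ^ q / (t / s) ^ 2 := by
    rw [Real.rpow_sub hu, Real.rpow_two]
  calc φ' t / t = t * φ' t / t ^ 2 := by field_simp
    _ ≤ p₂ * (φ s * (t / s) ^ q) / t ^ 2 := by
      refine div_le_div_of_nonneg_right ?_ (by positivity)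
      exact (h2 t ht).trans (mul_le_mul_of_nonneg_left (le_mul_div_rpow_of_mul_le hd h1 ht hts) hp₂)
    _ = p₂ * (φ s / s ^ 2) * (t / s) ^ (q - 2) := by rw [e]; field_simp
    _ ≤ _ := by
      have := h0 s hs
      exact mul_le_mul_of_nonneg_left
        (Real.rpow_le_rpow_of_nonpos hx hxt (by linarith)) (by positivity)

lemma le_deriv_div {q s t x : ℝ} (hd : ∀ t > (0 : ℝ), HasDerivAt φ (φ' t) t)
    (h0 : ∀ t > (0 : ℝ), 0 ≤ φ t) (hp₁ : 0 ≤ p₁)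
    (h1 : ∀ t > (0 : ℝ), p₁ * φ t ≤ t * φ' t) (h2 : ∀ t > (0 : ℝ), t * φ' t ≤ q * φ t)
    (hq : 2 ≤ q) (hx : 0 < x) (hxt : x ≤ t / s) (hs : 0 < s) (hts : t ≤ s) :
    p₁ * (φ s / s ^ 2) * x ^ (q - 2) ≤ φ' t / t := by
  have hu : 0 < t / s := hx.trans_le hxt
  have ht : 0 < t := by simpa [hs.ne'] using mul_pos hu hs
  have e : (t / s) ^ (q - 2) = (t / s) ^ q / (t / s) ^ 2 := by
    rw [Real.rpow_sub hu, Real.rpow_two]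
  calc _ ≤ p₁ * (φ s / s ^ 2) * (t / s) ^ (q - 2) := by
        have := h0 s hs
        exact mul_le_mul_of_nonneg_left
          (Real.rpow_le_rpow hx.le hxt (by linarith)) (by positivity)
    _ = p₁ * (φ s * (t / s) ^ q) / t ^ 2 := by rw [e]; field_simp
    _ ≤ t * φ' t / t ^ 2 := by
      refine div_le_div_of_nonneg_right ?_ (by positivity)
      exact (mul_le_mul_of_nonneg_left (mul_div_rpow_le_of_le_mul hd h2 ht hts) hp₁).trans (h1 t ht)
    _ = φ' t / t := by field_simp

/-- Off a null set, a parameter in `[0, 1]` differs from `a`. -/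
lemma ae_restrict_Icc_abs_sub_pos (a : ℝ) :
    ∀ᵐ θ ∂(volume.restrict (Icc (0 : ℝ) 1)), 0 < |a - θ| ∧ θ ∈ Icc (0 : ℝ) 1 := by
  have h : ∀ᵐ θ ∂(volume : Measure ℝ), θ ≠ a := by simp [ae_iff]
  filter_upwards [ae_restrict_of_ae h, ae_restrict_mem measurableSet_Icc] with θ hθ hm
  exact ⟨abs_pos.2 (sub_ne_zero.2 hθ.symm), hm⟩

variable {E : Type*} [NormedAddCommGroup E]

lemma deriv_norm_div_nonneg (hp₁ : 0 ≤ p₁) (h0 : ∀ t > (0 : ℝ), 0 ≤ φ t)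
    (h1 : ∀ t > (0 : ℝ), p₁ * φ t ≤ t * φ' t) (P : E) : 0 ≤ φ' ‖P‖ / ‖P‖ := by
  rcases (norm_nonneg P).eq_or_lt with h | h
  · simp [← h]
  · exact div_nonneg (nonneg_of_mul_nonneg_right
      ((mul_nonneg hp₁ (h0 _ h)).trans (h1 _ h)) h) h.le

lemma norm_div_norm_add_norm_mem_Icc (P₀ P₁ : E) :
    ‖P₀‖ / (‖P₀‖ + ‖P₁‖) ∈ Icc (0 : ℝ) 1 :=
  ⟨by positivity, div_le_one_of_le₀ (by linarith [norm_nonneg P₁]) (by positivity)⟩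

variable [NormedSpace ℝ E]

lemma norm_segment_le (P₀ P₁ : E) {θ : ℝ} (hθ : θ ∈ Icc (0 : ℝ) 1) :
    ‖(1 - θ) • P₀ + θ • P₁‖ ≤ ‖P₀‖ + ‖P₁‖ := by
  refine (norm_add_le _ _).trans ?_
  rw [norm_smul, norm_smul, Real.norm_of_nonneg (sub_nonneg.2 hθ.2), Real.norm_of_nonneg hθ.1]
  exact add_le_add (mul_le_of_le_one_left (norm_nonneg _) (sub_le_self 1 hθ.1))
    (mul_le_of_le_one_left (norm_nonneg _) hθ.2)

lemma abs_sub_le_norm_segment_div {P₀ P₁ : E} (hs : 0 < ‖P₀‖ + ‖P₁‖) {θ : ℝ}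
    (hθ : θ ∈ Icc (0 : ℝ) 1) :
    |‖P₀‖ / (‖P₀‖ + ‖P₁‖) - θ| ≤ ‖(1 - θ) • P₀ + θ • P₁‖ / (‖P₀‖ + ‖P₁‖) := by
  have h := abs_norm_sub_norm_le ((1 - θ) • P₀) (-(θ • P₁))
  rw [sub_neg_eq_add, norm_neg, norm_smul, norm_smul, Real.norm_of_nonneg (sub_nonneg.2 hθ.2),
    Real.norm_of_nonneg hθ.1] at h
  rw [le_div_iff₀ hs]
  calc _ = |(‖P₀‖ / (‖P₀‖ + ‖P₁‖) - θ) * (‖P₀‖ + ‖P₁‖)| := by rw [abs_mul, abs_of_pos hs]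
    _ = |(1 - θ) * ‖P₀‖ - θ * ‖P₁‖| := by congr 1; field_simp; ring
    _ ≤ _ := h

lemma measurable_deriv_norm_segment_div
    (hd : ∀ t > (0 : ℝ), HasDerivAt φ (φ' t) t) (P₀ P₁ : E) :
    Measurable fun θ : ℝ => φ' ‖(1 - θ) • P₀ + θ • P₁‖ / ‖(1 - θ) • P₀ + θ • P₁‖ := by
  have e : (fun θ : ℝ => φ' ‖(1 - θ) • P₀ + θ • P₁‖ / ‖(1 - θ) • P₀ + θ • P₁‖) =
      (fun t => deriv φ t / t) ∘ fun θ : ℝ => ‖(1 - θ) • P₀ + θ • P₁‖ := by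
    ext θ
    rcases (norm_nonneg ((1 - θ) • P₀ + θ • P₁)).eq_or_lt with h | h
    · simp [← h]
    · simp [(hd _ h).deriv]
  rw [e]
  have hc : Continuous fun θ : ℝ => ‖(1 - θ) • P₀ + θ • P₁‖ := by fun_prop
  exact ((measurable_deriv φ).div measurable_id).comp hc.measurable

lemma intervalIntegrable_deriv_norm_segment_div {q : ℝ}
    (hd : ∀ t > (0 : ℝ), HasDerivAt φ (φ' t) t) (h0 : ∀ t > (0 : ℝ), 0 ≤ φ t)
    (hq1 : 1 < q) (hq2 : q ≤ 2) (hp₂ : 0 ≤ p₂)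
    (h1 : ∀ t > (0 : ℝ), q * φ t ≤ t * φ' t) (h2 : ∀ t > (0 : ℝ), t * φ' t ≤ p₂ * φ t)
    {P₀ P₁ : E} (hs : 0 < ‖P₀‖ + ‖P₁‖) :
    IntervalIntegrable (fun θ : ℝ => φ' ‖(1 - θ) • P₀ + θ • P₁‖ / ‖(1 - θ) • P₀ + θ • P₁‖)
        volume 0 1 ∧
      ∫ θ in (0 : ℝ)..1, φ' ‖(1 - θ) • P₀ + θ • P₁‖ / ‖(1 - θ) • P₀ + θ • P₁‖ ≤
        p₂ * (φ (‖P₀‖ + ‖P₁‖) / (‖P₀‖ + ‖P₁‖) ^ 2) * (2 / (q - 1)) := by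
  have ha := norm_div_norm_add_norm_mem_Icc P₀ P₁
  have hr : -1 < q - 2 := by linarith
  have hle : (fun θ : ℝ => φ' ‖(1 - θ) • P₀ + θ • P₁‖ / ‖(1 - θ) • P₀ + θ • P₁‖)
      ≤ᵐ[volume.restrict (Icc (0 : ℝ) 1)] fun θ => p₂ * (φ (‖P₀‖ + ‖P₁‖) / (‖P₀‖ + ‖P₁‖) ^ 2) *
        |‖P₀‖ / (‖P₀‖ + ‖P₁‖) - θ| ^ (q - 2) := by
    filter_upwards [ae_restrict_Icc_abs_sub_pos (‖P₀‖ / (‖P₀‖ + ‖P₁‖))] with θ hθ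
    exact deriv_div_le hd h0 hp₂ h1 h2 hq2 hθ.1 (abs_sub_le_norm_segment_div hs hθ.2) hs
      (norm_segment_le P₀ P₁ hθ.2)
  have hI := (intervalIntegrable_abs_sub_rpow hr ha).const_mul
    (p₂ * (φ (‖P₀‖ + ‖P₁‖) / (‖P₀‖ + ‖P₁‖) ^ 2))
  have hint : IntervalIntegrable
      (fun θ : ℝ => φ' ‖(1 - θ) • P₀ + θ • P₁‖ / ‖(1 - θ) • P₀ + θ • P₁‖) volume 0 1 := by
    refine hI.mono_fun (measurable_deriv_norm_segment_div hd P₀ P₁).aestronglyMeasurable ?_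
    rw [uIoc_of_le zero_le_one]
    filter_upwards [ae_restrict_of_ae_restrict_of_subset Ioc_subset_Icc_self hle] with θ hθ
    have hn := deriv_norm_div_nonneg (by linarith) h0 h1 ((1 - θ) • P₀ + θ • P₁)
    rw [Real.norm_of_nonneg hn, Real.norm_of_nonneg (hn.trans hθ)]
    exact hθ
  refine ⟨hint, (intervalIntegral.integral_mono_ae_restrict zero_le_one hint hI hle).trans ?_⟩
  rw [intervalIntegral.integral_const_mul]
  have := h0 _ hs
  refine mul_le_mul_of_nonneg_left ?_ (by positivity)
  have h := integral_abs_sub_rpow_le hr ha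
  rwa [show q - 2 + 1 = q - 1 by ring] at h

lemma le_integral_deriv_norm_segment_div {q : ℝ}
    (hd : ∀ t > (0 : ℝ), HasDerivAt φ (φ' t) t) (h0 : ∀ t > (0 : ℝ), 0 ≤ φ t)
    (hq : 2 ≤ q) (hp₁ : 0 ≤ p₁)
    (h1 : ∀ t > (0 : ℝ), p₁ * φ t ≤ t * φ' t) (h2 : ∀ t > (0 : ℝ), t * φ' t ≤ q * φ t)
    {P₀ P₁ : E} (hs : 0 < ‖P₀‖ + ‖P₁‖)
    (hint : IntervalIntegrable
      (fun θ : ℝ => φ' ‖(1 - θ) • P₀ + θ • P₁‖ / ‖(1 - θ) • P₀ + θ • P₁‖) volume 0 1) :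
    p₁ * (φ (‖P₀‖ + ‖P₁‖) / (‖P₀‖ + ‖P₁‖) ^ 2) * ((1 / 2) ^ (q - 1) / (q - 1)) ≤
      ∫ θ in (0 : ℝ)..1, φ' ‖(1 - θ) • P₀ + θ • P₁‖ / ‖(1 - θ) • P₀ + θ • P₁‖ := by
  have ha := norm_div_norm_add_norm_mem_Icc P₀ P₁
  have hr : -1 < q - 2 := by linarith
  have hI := (intervalIntegrable_abs_sub_rpow hr ha).const_mul
    (p₁ * (φ (‖P₀‖ + ‖P₁‖) / (‖P₀‖ + ‖P₁‖) ^ 2))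
  refine le_trans ?_ (intervalIntegral.integral_mono_ae_restrict zero_le_one hI hint ?_)
  · rw [intervalIntegral.integral_const_mul]
    have := h0 _ hs
    refine mul_le_mul_of_nonneg_left ?_ (by positivity)
    have h := le_integral_abs_sub_rpow hr ha
    rwa [show q - 2 + 1 = q - 1 by ring] at h
  · filter_upwards [ae_restrict_Icc_abs_sub_pos (‖P₀‖ / (‖P₀‖ + ‖P₁‖))] with θ hθ
    exact le_deriv_div hd h0 hp₁ h1 h2 hq hθ.1 (abs_sub_le_norm_segment_div hs hθ.2) hs
      (norm_segment_le P₀ P₁ hθ.2)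

end Segment


/-- for an N-function `φ` with indices `p₁ ≤ p₂`, one has
`∫₀¹ φ'(|(1−θ)P₀ + θP₁|)/|(1−θ)P₀ + θP₁| dθ ∼ φ'(|P₀|+|P₁|)/(|P₀|+|P₁|)`
with constants depending only on `p₁, p₂`. (In Lean, division by zero yields `0`, which
realizes the convention that the integrand vanishes where `(1−θ)P₀ + θP₁ = 0`.) -/
theorem stmt_10 (p₁ p₂ : ℝ) (hp₁ : 1 < p₁) (hp : p₁ ≤ p₂) :
    ∃ c : ℝ, 1 ≤ c ∧
      ∀ (N n : ℕ), 1 ≤ N → 1 ≤ n →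
      ∀ (φ φ' : ℝ → ℝ),
        φ 0 = 0 →
        (∀ t ∈ Set.Ici (0 : ℝ), 0 ≤ φ t) →
        (∀ t ∈ Set.Ici (0 : ℝ), HasDerivWithinAt φ (φ' t) (Set.Ici 0) t) →
        (∀ t > (0 : ℝ), p₁ * φ t ≤ t * φ' t ∧ t * φ' t ≤ p₂ * φ t) →
      ∀ P₀ P₁ : EuclideanSpace ℝ (Fin N × Fin n), 0 < ‖P₀‖ + ‖P₁‖ →
        c⁻¹ * (φ' (‖P₀‖ + ‖P₁‖) / (‖P₀‖ + ‖P₁‖)) ≤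
          (∫ θ in (0 : ℝ)..1, φ' ‖(1 - θ) • P₀ + θ • P₁‖ / ‖(1 - θ) • P₀ + θ • P₁‖) ∧
        (∫ θ in (0 : ℝ)..1, φ' ‖(1 - θ) • P₀ + θ • P₁‖ / ‖(1 - θ) • P₀ + θ • P₁‖) ≤
          c * (φ' (‖P₀‖ + ‖P₁‖) / (‖P₀‖ + ‖P₁‖)) := by
  set q := min p₁ 2
  set Q := max p₂ 2
  have hq1 : 1 < q := lt_min hp₁ one_lt_two
  have hQ2 : 2 ≤ Q := le_max_right _ _
  set A := p₂ / p₁ * (2 / (q - 1)) with hA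
  set k : ℝ := (1 / 2) ^ (Q - 1) / (Q - 1)
  have hk0 : 0 < k := div_pos (by positivity) (by linarith)
  have hp₁0 : 0 < p₁ := by linarith
  have hp₂0 : 0 < p₂ := by linarith
  refine ⟨max 1 (max A (p₂ / p₁ / k)), le_max_left _ _, ?_⟩
  intro N n _ _ φ φ' _ h0 hd hφ P₀ P₁ hs
  have hd' : ∀ t > (0 : ℝ), HasDerivAt φ (φ' t) t := fun t ht =>
    (hd t ht.le).hasDerivAt (Ici_mem_nhds ht)
  have h0' : ∀ t > (0 : ℝ), 0 ≤ φ t := fun t ht => h0 t ht.le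
  obtain ⟨hint, hup⟩ := intervalIntegrable_deriv_norm_segment_div hd' h0' hq1 (min_le_right _ _)
    hp₂0.le (fun t ht => (mul_le_mul_of_nonneg_right (min_le_left _ _) (h0' t ht)).trans (hφ t ht).1)
    (fun t ht => (hφ t ht).2) hs
  have hlow := le_integral_deriv_norm_segment_div hd' h0' hQ2 hp₁0.le (fun t ht => (hφ t ht).1)
    (fun t ht => (hφ t ht).2.trans (mul_le_mul_of_nonneg_right (le_max_left _ _) (h0' t ht))) hs hint
  set s := ‖P₀‖ + ‖P₁‖
  have e : φ' s / s = s * φ' s / s ^ 2 := by field_simp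
  have hg1 : p₁ * (φ s / s ^ 2) ≤ φ' s / s := by
    rw [e, ← mul_div_assoc]
    exact div_le_div_of_nonneg_right (hφ s hs).1 (by positivity)
  have hg2 : φ' s / s ≤ p₂ * (φ s / s ^ 2) := by
    rw [e, ← mul_div_assoc]
    exact div_le_div_of_nonneg_right (hφ s hs).2 (by positivity)
  have hF : 0 ≤ φ s / s ^ 2 := div_nonneg (h0' s hs) (by positivity)
  have hg0 : 0 ≤ φ' s / s := (mul_nonneg hp₁0.le hF).trans hg1
  have hq0 : 0 < q - 1 := by linarith
  constructor
  · refine le_trans ?_ hlow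
    have hc : p₂ / p₁ / k ≤ max 1 (max A (p₂ / p₁ / k)) :=
      (le_max_right _ _).trans (le_max_right _ _)
    calc _ ≤ (p₂ / p₁ / k)⁻¹ * (φ' s / s) := by gcongr
      _ ≤ (p₂ / p₁ / k)⁻¹ * (p₂ * (φ s / s ^ 2)) := by gcongr
      _ = p₁ * (φ s / s ^ 2) * k := by field_simp
  · refine hup.trans ?_
    calc p₂ * (φ s / s ^ 2) * (2 / (q - 1)) = A * (p₁ * (φ s / s ^ 2)) := by
          rw [hA]; field_simp
      _ ≤ A * (φ' s / s) := by gcongr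
      _ ≤ _ := by
        gcongr
        exact (le_max_left _ _).trans (le_max_right _ _)
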